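/- arXiv:1503.07054 — 8 statements merged into one kernel-verified Lean document; each statement's English description precedes it below -/
import Mathlib

section
/- (Eckart–Young) Let A = U Σ Vᵀ be an SVD of a real m×n matrix A and let 1 ≤ r ≤ rank(A). Then the truncation B_r = U Σ_{{1,…,r}} Vᵀ (keeping the r largest singular values and zeroing the others) is a best rank-r approximation of A: for every real m×n matrix X with rank(X) ≤ r, ‖A − B_r‖ ≤ ‖A − X‖ in the Frobenius norm. -/
open Matrix

/-- The truncation of the pseudodiagonal matrix `S` keeping only the diagonal
entries with index in the set `T` (0-indexed). -/
def sigmaTrunc {m n : ℕ} (S : Matrix (Fin m) (Fin n) ℝ) (T : Finset ℕ) :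
    Matrix (Fin m) (Fin n) ℝ :=
  Matrix.of fun i j => if (i : ℕ) = (j : ℕ) ∧ (i : ℕ) ∈ T then S i j else 0

/-- The Frobenius norm of a matrix. -/
noncomputable def frobNorm {m n : ℕ} (M : Matrix (Fin m) (Fin n) ℝ) : ℝ :=
  Real.sqrt (Matrix.trace (M * Mᵀ))

/-- Every subspace of Euclidean space is fixed pointwise by an orthogonal projection matrix whose
trace is the dimension of the subspace. -/
theorem exists_orthogonal_projection_matrix {m : ℕ} (K : Submodule ℝ (EuclideanSpace ℝ (Fin m))) :
    ∃ P : Matrix (Fin m) (Fin m) ℝ, Pᵀ = P ∧ P * P = P ∧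
      (∀ y ∈ K, P *ᵥ y.ofLp = y.ofLp) ∧ P.trace = Module.finrank ℝ K := by
  obtain ⟨b⟩ : Nonempty (OrthonormalBasis (Fin (Module.finrank ℝ K)) ℝ K) :=
    ⟨stdOrthonormalBasis ℝ K⟩
  let Q : Matrix (Fin m) (Fin (Module.finrank ℝ K)) ℝ :=
    Matrix.of fun i l => (b l : EuclideanSpace ℝ (Fin m)) i
  have hinner : ∀ (l : Fin (Module.finrank ℝ K)) (y : K),
      inner ℝ (b l) y = (Qᵀ *ᵥ (y : EuclideanSpace ℝ (Fin m)).ofLp) l := by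
    intro l y
    rw [Submodule.coe_inner, PiLp.inner_apply]
    exact Finset.sum_congr rfl fun i _ => mul_comm _ _
  have hQ : Qᵀ * Q = 1 := by
    ext k l
    rw [Matrix.one_apply, ← orthonormal_iff_ite.mp b.orthonormal k l, hinner]
    rfl
  refine ⟨Q * Qᵀ, by simp, ?_, fun y hy => ?_, ?_⟩
  · rw [Matrix.mul_assoc, ← Matrix.mul_assoc Qᵀ, hQ, Matrix.one_mul]
  · ext i
    have h := congrArg (fun z : K => (z : EuclideanSpace ℝ (Fin m)) i) (b.sum_repr' ⟨y, hy⟩)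
    simp only [hinner, Submodule.coe_sum, Submodule.coe_smul, WithLp.ofLp_sum, Finset.sum_apply,
      WithLp.ofLp_smul, Pi.smul_apply, smul_eq_mul] at h
    rw [← h, ← Matrix.mulVec_mulVec]
    change ∑ l, Q i l * (Qᵀ *ᵥ y.ofLp) l = ∑ l, (Qᵀ *ᵥ y.ofLp) l * Q i l
    exact Finset.sum_congr rfl fun l _ => mul_comm (Q i l) ((Qᵀ *ᵥ y.ofLp) l)
  · rw [Matrix.trace_mul_comm, hQ, Matrix.trace_one, Fintype.card_fin]

/-- A real matrix admits an orthogonal projection matrix that fixes its columns and whose trace is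
its rank. -/
theorem exists_orthogonal_projection_fixing {m n : ℕ} (Y : Matrix (Fin m) (Fin n) ℝ) :
    ∃ P : Matrix (Fin m) (Fin m) ℝ, Pᵀ = P ∧ P * P = P ∧ P * Y = Y ∧ P.trace = Y.rank := by
  obtain ⟨P, hsymm, hidem, hfix, htrace⟩ :=
    exists_orthogonal_projection_matrix (LinearMap.range (Matrix.toEuclideanLin Y))
  refine ⟨P, hsymm, hidem, ?_, ?_⟩
  · refine Matrix.ext_of_mulVec_single fun j => ?_
    rw [← Matrix.mulVec_mulVec]
    exact hfix _ (LinearMap.mem_range_self _ (WithLp.toLp 2 (Pi.single j 1)))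
  · rw [htrace, Matrix.rank_eq_finrank_range_toLin Y (EuclideanSpace.basisFun _ ℝ).toBasis
      (EuclideanSpace.basisFun _ ℝ).toBasis, ← Matrix.toEuclideanLin_eq_toLin_orthonormal]

/-- The squared Frobenius norm is the sum of the squares of the entries. -/
theorem trace_mul_transpose_self_eq_sum {m n : ℕ} (M : Matrix (Fin m) (Fin n) ℝ) :
    (M * Mᵀ).trace = ∑ i, ∑ j, M i j ^ 2 := by
  simp [Matrix.trace, Matrix.mul_apply, sq]

theorem trace_mul_transpose_self_nonneg {m n : ℕ} (M : Matrix (Fin m) (Fin n) ℝ) :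
    0 ≤ (M * Mᵀ).trace := by
  rw [trace_mul_transpose_self_eq_sum]
  positivity

/-- The Frobenius norm is invariant under orthogonal changes of basis. -/
theorem frobNorm_orthogonal_mul_mul {m n : ℕ} (U : Matrix (Fin m) (Fin m) ℝ)
    (V : Matrix (Fin n) (Fin n) ℝ) (hU : U * Uᵀ = 1) (hV : V * Vᵀ = 1)
    (M : Matrix (Fin m) (Fin n) ℝ) : frobNorm (U * M * Vᵀ) = frobNorm M := by
  have hU' : Uᵀ * U = 1 := mul_eq_one_comm.mp hU
  have hV' : Vᵀ * V = 1 := mul_eq_one_comm.mp hV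
  have h : U * M * Vᵀ * (U * M * Vᵀ)ᵀ = U * (M * Mᵀ * Uᵀ) := by
    simp only [Matrix.transpose_mul, Matrix.transpose_transpose, Matrix.mul_assoc]
    rw [← Matrix.mul_assoc Vᵀ, hV', Matrix.one_mul]
  rw [frobNorm, frobNorm, h, Matrix.trace_mul_comm, Matrix.mul_assoc, hU', Matrix.mul_one]

/-- The diagonal entries of an orthogonal projection matrix lie in `[0, 1]`. -/
theorem diag_mem_Icc_of_isSymm_of_idempotent {m : ℕ} {P : Matrix (Fin m) (Fin m) ℝ}
    (hsymm : Pᵀ = P) (hidem : P * P = P) (i : Fin m) : P i i ∈ Set.Icc (0 : ℝ) 1 := by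
  have h : P i i = ∑ j, P i j ^ 2 := by
    conv_lhs => rw [← hidem]
    rw [Matrix.mul_apply]
    refine Finset.sum_congr rfl fun j _ => ?_
    rw [sq, ← Matrix.transpose_apply P, hsymm]
  have h0 : 0 ≤ P i i := by rw [h]; positivity
  have h1 : P i i ^ 2 ≤ P i i := by
    conv_rhs => rw [h]
    exact Finset.single_le_sum (f := fun j => P i j ^ 2) (fun j _ => sq_nonneg _)
      (Finset.mem_univ i)
  exact ⟨h0, by nlinarith⟩

/-- A weighted sum of a nonnegative antitone sequence with weights in `[0, 1]` of total weight at
most `r` is at most the sum of the first `r` terms. -/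
theorem sum_mul_le_sum_first {m : ℕ} (r : ℕ) {d p : Fin m → ℝ} (hd : Antitone d)
    (hd0 : ∀ i, 0 ≤ d i) (hp : ∀ i, p i ∈ Set.Icc (0 : ℝ) 1) (hsum : ∑ i, p i ≤ r) :
    ∑ i, p i * d i ≤ ∑ i : Fin m, if (i : ℕ) < r then d i else 0 := by
  rcases le_or_gt m r with hmr | hrm
  · refine Finset.sum_le_sum fun i _ => ?_
    rw [if_pos (i.isLt.trans_le hmr)]
    exact mul_le_of_le_one_left (hd0 i) (hp i).2
  · set c := d ⟨r, hrm⟩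
    have hcard : ∑ i : Fin m, (if (i : ℕ) < r then (1 : ℝ) else 0) = r := by
      rw [Fin.sum_univ_eq_sum_range (fun i => if i < r then (1 : ℝ) else 0) m,
        ← Finset.sum_filter, Finset.sum_const, nsmul_eq_mul, mul_one]
      congr 1
      have : Finset.filter (fun i => i < r) (Finset.range m) = Finset.range r := by
        ext i
        simp only [Finset.mem_filter, Finset.mem_range]
        omega
      rw [this, Finset.card_range]
    have hterm : ∀ i : Fin m, p i * d i ≤ (if (i : ℕ) < r then d i else 0) +
        c * (p i - if (i : ℕ) < r then (1 : ℝ) else 0) := by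
      intro i
      obtain ⟨h0, h1⟩ := hp i
      split_ifs with hi
      · have : c ≤ d i := hd (Fin.mk_le_mk.mpr hi.le)
        nlinarith
      · have : d i ≤ c := hd (Fin.mk_le_mk.mpr (not_lt.mp hi))
        nlinarith
    have h := Finset.sum_le_sum fun i (_ : i ∈ Finset.univ) => hterm i
    rw [Finset.sum_add_distrib, ← Finset.mul_sum, Finset.sum_sub_distrib, hcard] at h
    nlinarith [hd0 ⟨r, hrm⟩]

/-- An orthogonal projection fixing `Y` gives a lower bound for the distance from `S` to `Y`. -/
theorem trace_sub_trace_projection_le {m n : ℕ} {P : Matrix (Fin m) (Fin m) ℝ}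
    {S Y : Matrix (Fin m) (Fin n) ℝ} (hsymm : Pᵀ = P) (hidem : P * P = P) (hfix : P * Y = Y) :
    (S * Sᵀ).trace - (P * (S * Sᵀ)).trace ≤ ((S - Y) * (S - Y)ᵀ).trace := by
  have key : ∀ M : Matrix (Fin m) (Fin n) ℝ,
      ((M - P * M) * (M - P * M)ᵀ).trace = (M * Mᵀ).trace - (P * (M * Mᵀ)).trace ∧
      ((P * M) * (P * M)ᵀ).trace = (P * (M * Mᵀ)).trace := by
    intro M
    have h1 : (M * (Mᵀ * P)).trace = (P * (M * Mᵀ)).trace := by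
      rw [← Matrix.mul_assoc, Matrix.trace_mul_comm]
    have h2 : (P * (M * (Mᵀ * P))).trace = (P * (M * Mᵀ)).trace := by
      rw [Matrix.trace_mul_comm, ← Matrix.mul_assoc M, Matrix.mul_assoc, hidem,
        Matrix.trace_mul_comm]
    simp only [Matrix.transpose_sub, Matrix.transpose_mul, hsymm, Matrix.sub_mul, Matrix.mul_sub,
      Matrix.mul_assoc, Matrix.trace_sub, h1, h2]
    exact ⟨by ring, trivial⟩
  have hres : S - Y - P * (S - Y) = S - P * S := by
    rw [Matrix.mul_sub, hfix]
    abel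
  have h1 := (key (S - Y)).1
  rw [hres, (key S).1] at h1
  linarith [(key (S - Y)).2, trace_mul_transpose_self_nonneg (P * (S - Y))]

/-- Eckart–Young: if `A = U S Vᵀ` is an SVD of `A` and `1 ≤ r ≤ rank A`, then the
truncation `U S_{1..r} Vᵀ` is a best rank-`r` approximation of `A` in Frobenius norm. -/
theorem eckart_young {m n : ℕ}
    (A : Matrix (Fin m) (Fin n) ℝ) (U : Matrix (Fin m) (Fin m) ℝ)
    (V : Matrix (Fin n) (Fin n) ℝ) (S : Matrix (Fin m) (Fin n) ℝ)
    (hU : U * Uᵀ = 1) (hV : V * Vᵀ = 1)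
    (hdiag : ∀ (i : Fin m) (j : Fin n), (i : ℕ) ≠ (j : ℕ) → S i j = 0)
    (hnonneg : ∀ (i : Fin m) (j : Fin n), (i : ℕ) = (j : ℕ) → 0 ≤ S i j)
    (hord : ∀ (i i' : Fin m) (j j' : Fin n), (i : ℕ) = (j : ℕ) → (i' : ℕ) = (j' : ℕ) →
      (i : ℕ) ≤ (i' : ℕ) → S i' j' ≤ S i j)
    (hA : A = U * S * Vᵀ)
    (r : ℕ) (hr1 : 1 ≤ r) (hr2 : r ≤ A.rank) :
    ∀ X : Matrix (Fin m) (Fin n) ℝ, X.rank ≤ r →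
      frobNorm (A - U * sigmaTrunc S (Finset.range r) * Vᵀ) ≤ frobNorm (A - X) := by
  intro X hX
  have hU' : Uᵀ * U = 1 := mul_eq_one_comm.mp hU
  set T := S - sigmaTrunc S (Finset.range r)
  set Y := Uᵀ * X * V
  have hXY : X = U * Y * Vᵀ := by
    simp only [Y, Matrix.mul_assoc, hV, Matrix.mul_one]
    rw [← Matrix.mul_assoc, hU, Matrix.one_mul]
  have hYr : Y.rank ≤ r :=
    ((Matrix.rank_mul_le_left _ _).trans (Matrix.rank_mul_le_right _ _)).trans hX
  rw [show A - U * sigmaTrunc S (Finset.range r) * Vᵀ = U * T * Vᵀ by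
      rw [hA, Matrix.mul_sub, Matrix.sub_mul],
    show A - X = U * (S - Y) * Vᵀ by rw [hA, Matrix.mul_sub, Matrix.sub_mul, ← hXY],
    frobNorm_orthogonal_mul_mul U V hU hV, frobNorm_orthogonal_mul_mul U V hU hV]
  refine Real.sqrt_le_sqrt ?_
  obtain ⟨P, hsymm, hidem, hfix, htrace⟩ := exists_orthogonal_projection_fixing Y
  refine le_trans ?_ (trace_sub_trace_projection_le hsymm hidem hfix)
  set d : Fin m → ℝ := fun i => ∑ j, S i j ^ 2
  have hd0 : ∀ i, 0 ≤ d i := fun i => by positivity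
  have hd_eq : ∀ (i : Fin m) (h : (i : ℕ) < n), d i = S i ⟨i, h⟩ ^ 2 := fun i h =>
    Finset.sum_eq_single_of_mem _ (Finset.mem_univ _) fun j _ hj => by
      rw [hdiag i j fun hij => hj (Fin.ext hij.symm), zero_pow two_ne_zero]
  have hd : Antitone d := by
    intro i k hik
    rcases lt_or_ge (k : ℕ) n with hk | hk
    · have hi : (i : ℕ) < n := lt_of_le_of_lt hik hk
      rw [hd_eq i hi, hd_eq k hk]
      exact pow_le_pow_left₀ (hnonneg _ _ rfl) (hord _ _ _ _ rfl rfl hik) 2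
    · have : d k = 0 := Finset.sum_eq_zero fun j _ => by
        rw [hdiag k j (by omega), zero_pow two_ne_zero]
      rw [this]
      exact hd0 i
  have hSS : S * Sᵀ = Matrix.diagonal d := by
    ext i k
    rw [Matrix.mul_apply, Matrix.diagonal_apply]
    split_ifs with hik
    · subst hik
      simp [d, sq]
    · refine Finset.sum_eq_zero fun j _ => ?_
      by_cases hij : (i : ℕ) = j
      · rw [Matrix.transpose_apply, hdiag k j fun hkj => hik (Fin.ext (hij.trans hkj.symm)),
          mul_zero]
      · rw [hdiag i j hij, zero_mul]
  have hT : (T * Tᵀ).trace = ∑ i, (d i - if (i : ℕ) < r then d i else 0) := by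
    rw [trace_mul_transpose_self_eq_sum]
    refine Finset.sum_congr rfl fun i _ => ?_
    have hTij : ∀ j, T i j = if (i : ℕ) < r then 0 else S i j := by
      intro j
      by_cases hij : (i : ℕ) = j
      · by_cases hi : (j : ℕ) < r <;> simp [T, sigmaTrunc, hij, hi]
      · simp [T, sigmaTrunc, hij, hdiag i j hij]
    simp only [hTij]
    split_ifs <;> simp [d]
  have hP : (P * (S * Sᵀ)).trace = ∑ i, P i i * d i := by
    simp [hSS, Matrix.trace, Matrix.mul_diagonal]
  have hmain := sum_mul_le_sum_first r hd hd0
    (fun i => diag_mem_Icc_of_isSymm_of_idempotent hsymm hidem i)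
    (show P.trace ≤ r by rw [htrace]; exact_mod_cast hYr)
  rw [hT, hP, hSS, Matrix.trace_diagonal, Finset.sum_sub_distrib]
  linarith
end

section
/- (Eckart–Young revisited, forward direction) Let A = U Σ Vᵀ be an SVD of a real m×n matrix A, let 1 ≤ r ≤ rank(A), and let S ⊆ {1,…,rank(A)} with |S| = r. Then B = U Σ_S Vᵀ has rank r and is a critical point of the Frobenius-distance function from A to the variety of matrices of rank ≤ r, i.e. (A − B)ᵀ B = 0 and (A − B) Bᵀ = 0. -/
open Matrix

open Classical in
/-- The rank of a real pseudodiagonal matrix is the number of its nonzero rows. -/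
theorem rank_eq_card_of_pseudodiagonal {m n : ℕ} (M : Matrix (Fin m) (Fin n) ℝ)
    (hM : ∀ (i : Fin m) (j : Fin n), (i : ℕ) ≠ (j : ℕ) → M i j = 0) :
    M.rank = (Finset.univ.filter fun i => ∃ j, M i j ≠ 0).card := by
  have hdiagonal : M * Mᵀ = diagonal fun i => ∑ j, M i j * M i j := by
    ext i i'
    rw [mul_apply, diagonal_apply]
    split_ifs with h
    · subst h
      rfl
    · refine Finset.sum_eq_zero fun j _ => ?_
      by_cases hj : (i : ℕ) = j
      · rw [transpose_apply, hM i' j fun h' => h (Fin.ext (hj.trans h'.symm)), mul_zero]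
      · rw [hM i j hj, zero_mul]
  rw [← rank_self_mul_transpose, hdiagonal, rank_diagonal, Fintype.card_subtype]
  refine congrArg Finset.card (Finset.ext fun i => ?_)
  simp [Finset.sum_eq_zero_iff_of_nonneg fun j _ => mul_self_nonneg (M i j)]

/-- A downward closed set of elements of `Fin m` contains every `i` below its cardinality. -/
theorem mem_of_val_lt_card_of_isLowerSet {m : ℕ} {P : Finset (Fin m)}
    (hP : IsLowerSet (P : Set (Fin m))) {i : Fin m} (hi : (i : ℕ) < P.card) : i ∈ P := by
  by_contra h
  have hsub : P ⊆ Finset.Iio i := fun k hk =>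
    Finset.mem_Iio.2 (lt_of_not_ge fun hik => h (hP hik hk))
  have := Finset.card_le_card hsub
  rw [Fin.card_Iio] at this
  omega

theorem sigmaTrunc_apply_of_ne {m n : ℕ} (S : Matrix (Fin m) (Fin n) ℝ) (T : Finset ℕ)
    {i : Fin m} {j : Fin n} (h : (i : ℕ) ≠ j) : sigmaTrunc S T i j = 0 := by
  simp [sigmaTrunc, h]

open Classical in
theorem rank_sigmaTrunc {m n : ℕ} (S : Matrix (Fin m) (Fin n) ℝ)
    (hdiag : ∀ (i : Fin m) (j : Fin n), (i : ℕ) ≠ (j : ℕ) → S i j = 0)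
    (hnonneg : ∀ (i : Fin m) (j : Fin n), (i : ℕ) = (j : ℕ) → 0 ≤ S i j)
    (hord : ∀ (i i' : Fin m) (j j' : Fin n), (i : ℕ) = (j : ℕ) → (i' : ℕ) = (j' : ℕ) →
      (i : ℕ) ≤ (i' : ℕ) → S i' j' ≤ S i j)
    (T : Finset ℕ) (hT : ∀ k ∈ T, k < S.rank) : (sigmaTrunc S T).rank = T.card := by
  have hlower : IsLowerSet
      ((Finset.univ.filter fun i => ∃ j, S i j ≠ 0 : Finset (Fin m)) : Set (Fin m)) := by
    intro i i' hle hi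
    simp only [Finset.coe_filter, Finset.mem_univ, true_and, Set.mem_ofPred_eq] at hi ⊢
    obtain ⟨j, hj⟩ := hi
    have hij : (i : ℕ) = j := not_imp_comm.1 (hdiag i j) hj
    have hle' : (i' : ℕ) ≤ i := hle
    refine ⟨⟨i', by omega⟩, ne_of_gt ?_⟩
    exact ((hnonneg i j hij).lt_of_ne' hj).trans_le (hord _ _ _ _ rfl hij hle')
  rw [rank_eq_card_of_pseudodiagonal _ fun i j => sigmaTrunc_apply_of_ne S T]
  refine Finset.card_bij (fun i _ => (i : ℕ)) ?_ (fun _ _ _ _ h => Fin.ext h) ?_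
  · intro i hi
    obtain ⟨j, hj⟩ := (Finset.mem_filter.1 hi).2
    by_contra h
    exact hj (by simp [sigmaTrunc, h])
  · intro k hk
    have hkr := hT k hk
    have hkm : k < m := hkr.trans_le (by simpa using S.rank_le_height)
    rw [rank_eq_card_of_pseudodiagonal S hdiag] at hkr
    have hmem := mem_of_val_lt_card_of_isLowerSet hlower (i := ⟨k, hkm⟩) hkr
    obtain ⟨j, hj⟩ := (Finset.mem_filter.1 hmem).2
    have hkj : k = j := not_imp_comm.1 (hdiag ⟨k, hkm⟩ j) hj
    refine ⟨⟨k, hkm⟩, Finset.mem_filter.2 ⟨Finset.mem_univ _, j, ?_⟩, rfl⟩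
    simpa [sigmaTrunc, ← hkj, hk] using hj

theorem sub_sigmaTrunc_transpose_mul {m n : ℕ} (S : Matrix (Fin m) (Fin n) ℝ)
    (hdiag : ∀ (i : Fin m) (j : Fin n), (i : ℕ) ≠ (j : ℕ) → S i j = 0) (T : Finset ℕ) :
    (S - sigmaTrunc S T)ᵀ * sigmaTrunc S T = 0 := by
  ext j j'
  rw [mul_apply]
  refine Finset.sum_eq_zero fun i _ => ?_
  by_cases hij : (i : ℕ) = j
  · by_cases hi : (i : ℕ) ∈ T <;> simp_all [sigmaTrunc]
  · simp [sigmaTrunc, hij, hdiag i j hij]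

theorem sub_sigmaTrunc_mul_transpose {m n : ℕ} (S : Matrix (Fin m) (Fin n) ℝ)
    (hdiag : ∀ (i : Fin m) (j : Fin n), (i : ℕ) ≠ (j : ℕ) → S i j = 0) (T : Finset ℕ) :
    (S - sigmaTrunc S T) * (sigmaTrunc S T)ᵀ = 0 := by
  ext i i'
  rw [mul_apply]
  refine Finset.sum_eq_zero fun j _ => ?_
  by_cases hij : (i : ℕ) = j
  · by_cases hi : (j : ℕ) ∈ T <;> by_cases hi' : (i' : ℕ) = j <;> simp_all [sigmaTrunc]
  · simp [sigmaTrunc, hij, hdiag i j hij]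

theorem rank_mul_mul_transpose_of_orthogonal {m n : ℕ} (U : Matrix (Fin m) (Fin m) ℝ)
    (V : Matrix (Fin n) (Fin n) ℝ) (hU : U * Uᵀ = 1) (hV : V * Vᵀ = 1)
    (M : Matrix (Fin m) (Fin n) ℝ) : (U * M * Vᵀ).rank = M.rank := by
  rw [rank_mul_eq_left_of_isUnit_det, rank_mul_eq_right_of_isUnit_det]
  · exact (isUnit_iff_isUnit_det _).1 (IsUnit.of_mul_eq_one _ hU)
  · exact (isUnit_iff_isUnit_det _).1 (IsUnit.of_mul_eq_one _ (mul_eq_one_comm.1 hV))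

/-- Eckart–Young revisited, forward direction: for any `r`-element subset `T` of the
(0-indexed) set `{0,…,rank A - 1}`, the matrix `B = U S_T Vᵀ` has rank `r` and is a
critical point of the Frobenius distance from `A` to the matrices of rank ≤ r,
i.e. `(A - B)ᵀ B = 0` and `(A - B) Bᵀ = 0`. -/
theorem eckart_young_critical_points {m n : ℕ}
    (A : Matrix (Fin m) (Fin n) ℝ) (U : Matrix (Fin m) (Fin m) ℝ)
    (V : Matrix (Fin n) (Fin n) ℝ) (S : Matrix (Fin m) (Fin n) ℝ)
    (hU : U * Uᵀ = 1) (hV : V * Vᵀ = 1)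
    (hdiag : ∀ (i : Fin m) (j : Fin n), (i : ℕ) ≠ (j : ℕ) → S i j = 0)
    (hnonneg : ∀ (i : Fin m) (j : Fin n), (i : ℕ) = (j : ℕ) → 0 ≤ S i j)
    (hord : ∀ (i i' : Fin m) (j j' : Fin n), (i : ℕ) = (j : ℕ) → (i' : ℕ) = (j' : ℕ) →
      (i : ℕ) ≤ (i' : ℕ) → S i' j' ≤ S i j)
    (hA : A = U * S * Vᵀ)
    (r : ℕ) (hr1 : 1 ≤ r) (hr2 : r ≤ A.rank)
    (T : Finset ℕ) (hT : ∀ k ∈ T, k < A.rank) (hTcard : T.card = r) :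
    (U * sigmaTrunc S T * Vᵀ).rank = r ∧
    (A - U * sigmaTrunc S T * Vᵀ)ᵀ * (U * sigmaTrunc S T * Vᵀ) = 0 ∧
    (A - U * sigmaTrunc S T * Vᵀ) * (U * sigmaTrunc S T * Vᵀ)ᵀ = 0 := by
  have hrank : A.rank = S.rank := by rw [hA, rank_mul_mul_transpose_of_orthogonal U V hU hV]
  have hsub : A - U * sigmaTrunc S T * Vᵀ = U * (S - sigmaTrunc S T) * Vᵀ := by
    rw [hA, Matrix.mul_sub, Matrix.sub_mul]
  have hU' : Uᵀ * U = 1 := mul_eq_one_comm.1 hU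
  have hV' : Vᵀ * V = 1 := mul_eq_one_comm.1 hV
  refine ⟨?_, ?_, ?_⟩
  · rw [rank_mul_mul_transpose_of_orthogonal U V hU hV,
      rank_sigmaTrunc S hdiag hnonneg hord T fun k hk => hrank ▸ hT k hk, hTcard]
  · calc (A - U * sigmaTrunc S T * Vᵀ)ᵀ * (U * sigmaTrunc S T * Vᵀ)
        = V * ((S - sigmaTrunc S T)ᵀ * (Uᵀ * U) * sigmaTrunc S T) * Vᵀ := by
          rw [hsub]
          simp only [transpose_mul, transpose_transpose, Matrix.mul_assoc]
      _ = 0 := by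
          rw [hU', Matrix.mul_one, sub_sigmaTrunc_transpose_mul S hdiag, Matrix.mul_zero,
            Matrix.zero_mul]
  · calc (A - U * sigmaTrunc S T * Vᵀ) * (U * sigmaTrunc S T * Vᵀ)ᵀ
        = U * ((S - sigmaTrunc S T) * (Vᵀ * V) * (sigmaTrunc S T)ᵀ) * Uᵀ := by
          rw [hsub]
          simp only [transpose_mul, transpose_transpose, Matrix.mul_assoc]
      _ = 0 := by
          rw [hV', Matrix.mul_one, sub_sigmaTrunc_mul_transpose S hdiag, Matrix.mul_zero,
            Matrix.zero_mul]
end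

section
/- (Baaijens–Draisma) Let A be a real n×n matrix with SVD A = U Σ Vᵀ whose singular values satisfy σ₁ > σ₂ > … > σ_n > 0. An orthogonal matrix Q is a critical point of the Frobenius-distance function from A to the orthogonal group O(n) — i.e. trace((A − Q)ᵀ Q S) = 0 for every skew-symmetric n×n matrix S, equivalently Aᵀ Q is symmetric — if and only if Q = U D Vᵀ for some diagonal matrix D whose diagonal entries are each +1 or −1. Moreover these 2ⁿ matrices U D Vᵀ are pairwise distinct, so there are exactly 2ⁿ critical points. -/
open Matrix

theorem Matrix.trace_mul_skew_eq_zero_iff {m : Type*} [Fintype m] (M : Matrix m m ℝ) :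
    (∀ W : Matrix m m ℝ, Wᵀ = -W → trace (M * W) = 0) ↔ Mᵀ = M := by
  constructor
  · intro h
    have h1 : trace (M * Mᵀ) - trace (M * M) = 0 := by
      rw [← trace_sub, ← Matrix.mul_sub]
      exact h _ (by rw [transpose_sub, transpose_transpose, neg_sub])
    have h2 : trace ((Mᵀ - M)ᴴ * (Mᵀ - M)) = 0 := by
      have e1 : trace (Mᵀ * Mᵀ) = trace (M * M) := by
        rw [← transpose_mul, trace_transpose]
      have e2 : trace (Mᵀ * M) = trace (M * Mᵀ) := trace_mul_comm _ _
      rw [conjTranspose_eq_transpose_of_trivial, transpose_sub, transpose_transpose,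
        Matrix.sub_mul, Matrix.mul_sub, Matrix.mul_sub, trace_sub, trace_sub, trace_sub, e1, e2]
      linarith
    exact sub_eq_zero.mp (trace_conjTranspose_mul_self_eq_zero_iff.mp h2)
  · intro hM W hW
    have h : trace (M * W) = -trace (M * W) := by
      conv_lhs => rw [← trace_transpose, transpose_mul, hM, hW, Matrix.neg_mul, trace_neg,
        trace_mul_comm]
    linarith

/-- An orthogonal matrix `P` for which `diagonal σ * P` is symmetric is a diagonal sign matrix,
provided the entries of `σ` are positive and distinct. -/
theorem Matrix.exists_eq_diagonal_sign_of_diagonal_mul_symm {m : Type*} [Fintype m]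
    [DecidableEq m] {σ : m → ℝ} (hpos : ∀ i, 0 < σ i) (hinj : Function.Injective σ)
    {P : Matrix m m ℝ} (hP : P * Pᵀ = 1) (hsymm : (diagonal σ * P)ᵀ = diagonal σ * P) :
    ∃ ε : m → ℝ, (∀ i, ε i = 1 ∨ ε i = -1) ∧ P = diagonal ε := by
  have hs : Pᵀ * diagonal σ = diagonal σ * P := by
    rwa [transpose_mul, diagonal_transpose] at hsymm
  have hPDP : P * (diagonal σ * P) = diagonal σ := by
    rw [← hs, ← Matrix.mul_assoc, hP, Matrix.one_mul]
  have hP' : Pᵀ * P = 1 := mul_eq_one_comm.mp hP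
  have hs' : P * diagonal σ = diagonal σ * Pᵀ := by
    calc P * diagonal σ = P * diagonal σ * (P * Pᵀ) := by rw [hP, Matrix.mul_one]
      _ = P * (diagonal σ * P) * Pᵀ := by simp only [Matrix.mul_assoc]
      _ = diagonal σ * Pᵀ := by rw [hPDP]
  have hoff : ∀ i j, i ≠ j → P i j = 0 := by
    intro i j hij
    have h1 := congrFun (congrFun hs i) j
    have h2 := congrFun (congrFun hs' i) j
    simp only [mul_diagonal, diagonal_mul, transpose_apply] at h1 h2
    have h3 : (σ i - σ j) * ((σ i + σ j) * P i j) = 0 := by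
      linear_combination -σ i * h1 - σ j * h2
    have hne : σ i - σ j ≠ 0 := sub_ne_zero.mpr fun h => hij (hinj h)
    have hne' : σ i + σ j ≠ 0 := (add_pos (hpos i) (hpos j)).ne'
    exact (mul_eq_zero.mp ((mul_eq_zero.mp h3).resolve_left hne)).resolve_left hne'
  have hdiag : P = diagonal fun i => P i i := by
    ext i j
    by_cases hij : i = j
    · subst hij
      rw [diagonal_apply_eq]
    · rw [diagonal_apply_ne _ hij, hoff i j hij]
  refine ⟨fun i => P i i, fun i => ?_, hdiag⟩
  rw [hdiag, diagonal_transpose, diagonal_mul_diagonal] at hP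
  have h := congrFun (congrFun hP i) i
  rw [diagonal_apply_eq, one_apply_eq] at h
  exact mul_self_eq_one_iff.mp h

/-- Baaijens–Draisma: let `A = U (diagonal σ) Vᵀ` be an SVD of a real `n×n` matrix
with strictly decreasing positive singular values. An orthogonal matrix `Q` is a
critical point of the Frobenius distance from `A` to `O(n)` (equivalently `Aᵀ Q` is
symmetric) iff `Q = U D Vᵀ` with `D` diagonal with entries `±1`; these `2ⁿ` matrices
are pairwise distinct, so there are exactly `2ⁿ` critical points. -/
theorem baaijens_draisma {n : ℕ}
    (A U V : Matrix (Fin n) (Fin n) ℝ) (σ : Fin n → ℝ)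
    (hU : U * Uᵀ = 1) (hV : V * Vᵀ = 1)
    (hpos : ∀ i, 0 < σ i) (hstrict : StrictAnti σ)
    (hA : A = U * Matrix.diagonal σ * Vᵀ) :
    (∀ Q : Matrix (Fin n) (Fin n) ℝ, Q * Qᵀ = 1 →
      (((∀ W : Matrix (Fin n) (Fin n) ℝ, Wᵀ = -W →
          Matrix.trace ((A - Q)ᵀ * Q * W) = 0) ↔ (Aᵀ * Q)ᵀ = Aᵀ * Q) ∧
       ((Aᵀ * Q)ᵀ = Aᵀ * Q ↔
          ∃ ε : Fin n → ℝ, (∀ i, ε i = 1 ∨ ε i = -1) ∧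
            Q = U * Matrix.diagonal ε * Vᵀ))) ∧
    (∀ ε ε' : Fin n → ℝ, (∀ i, ε i = 1 ∨ ε i = -1) → (∀ i, ε' i = 1 ∨ ε' i = -1) →
      U * Matrix.diagonal ε * Vᵀ = U * Matrix.diagonal ε' * Vᵀ → ε = ε') ∧
    Set.ncard {Q : Matrix (Fin n) (Fin n) ℝ |
        Q * Qᵀ = 1 ∧ (Aᵀ * Q)ᵀ = Aᵀ * Q} = 2 ^ n := by
  have hU' : Uᵀ * U = 1 := mul_eq_one_comm.mp hU
  have hV' : Vᵀ * V = 1 := mul_eq_one_comm.mp hV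
  have hconj : ∀ M : Matrix (Fin n) (Fin n) ℝ, Uᵀ * (U * M * Vᵀ) * V = M := fun M => by
    calc Uᵀ * (U * M * Vᵀ) * V = (Uᵀ * U) * M * (Vᵀ * V) := by simp only [Matrix.mul_assoc]
      _ = M := by rw [hU', hV', Matrix.one_mul, Matrix.mul_one]
  have hAQ : ∀ P : Matrix (Fin n) (Fin n) ℝ,
      Aᵀ * (U * P * Vᵀ) = V * (diagonal σ * P) * Vᵀ := fun P => by
    calc Aᵀ * (U * P * Vᵀ) = V * (diagonal σ * (Uᵀ * U) * P) * Vᵀ := by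
          simp only [hA, transpose_mul, transpose_transpose, diagonal_transpose, Matrix.mul_assoc]
      _ = V * (diagonal σ * P) * Vᵀ := by rw [hU', Matrix.mul_one]
  have hcrit : ∀ Q : Matrix (Fin n) (Fin n) ℝ, Q * Qᵀ = 1 →
      ((Aᵀ * Q)ᵀ = Aᵀ * Q ↔
        ∃ ε : Fin n → ℝ, (∀ i, ε i = 1 ∨ ε i = -1) ∧ Q = U * diagonal ε * Vᵀ) := by
    intro Q hQ
    constructor
    · intro hsymm
      have hQP : Q = U * (Uᵀ * Q * V) * Vᵀ := by
        calc Q = (U * Uᵀ) * Q * (V * Vᵀ) := by rw [hU, hV, Matrix.one_mul, Matrix.mul_one]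
          _ = U * (Uᵀ * Q * V) * Vᵀ := by simp only [Matrix.mul_assoc]
      have hP : (Uᵀ * Q * V) * (Uᵀ * Q * V)ᵀ = 1 := by
        calc (Uᵀ * Q * V) * (Uᵀ * Q * V)ᵀ = Uᵀ * (Q * (V * Vᵀ) * Qᵀ) * U := by
              simp only [transpose_mul, transpose_transpose, Matrix.mul_assoc]
          _ = 1 := by rw [hV, Matrix.mul_one, hQ, Matrix.mul_one, hU']
      have hD : diagonal σ * (Uᵀ * Q * V) = Vᵀ * (Aᵀ * Q) * V := by
        simp only [hA, transpose_mul, transpose_transpose, diagonal_transpose]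
        calc diagonal σ * (Uᵀ * Q * V) = (Vᵀ * V) * (diagonal σ * (Uᵀ * Q * V)) := by
              rw [hV', Matrix.one_mul]
          _ = _ := by simp only [Matrix.mul_assoc]
      obtain ⟨ε, hε, hPε⟩ := exists_eq_diagonal_sign_of_diagonal_mul_symm hpos
        hstrict.injective hP (by
          rw [hD, transpose_mul, transpose_mul, hsymm, transpose_transpose]
          simp only [Matrix.mul_assoc])
      exact ⟨ε, hε, by rw [← hPε]; exact hQP⟩
    · rintro ⟨ε, -, rfl⟩
      rw [hAQ, diagonal_mul_diagonal, transpose_mul, transpose_mul, transpose_transpose,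
        diagonal_transpose, Matrix.mul_assoc]
  have hinj : ∀ ε ε' : Fin n → ℝ,
      U * diagonal ε * Vᵀ = U * diagonal ε' * Vᵀ → ε = ε' := fun ε ε' h =>
    diagonal_injective (by rw [← hconj (diagonal ε), h, hconj])
  refine ⟨fun Q hQ => ⟨?_, hcrit Q hQ⟩, fun ε ε' _ _ => hinj ε ε', ?_⟩
  · have hQ' : Qᵀ * Q = 1 := mul_eq_one_comm.mp hQ
    rw [trace_mul_skew_eq_zero_iff, transpose_sub, Matrix.sub_mul, hQ', transpose_sub,
      transpose_one, sub_left_inj]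
  · let f : (Fin n → ℤˣ) → Matrix (Fin n) (Fin n) ℝ :=
      fun s => U * diagonal (fun i => ((s i : ℤ) : ℝ)) * Vᵀ
    have hf : Function.Injective f := fun s t h => by
      funext i
      have := congrFun (hinj _ _ h) i
      exact Units.ext (Int.cast_injective this)
    have hset : {Q : Matrix (Fin n) (Fin n) ℝ | Q * Qᵀ = 1 ∧ (Aᵀ * Q)ᵀ = Aᵀ * Q}
        = Set.range f := by
      ext Q
      constructor
      · rintro ⟨hQ, hs⟩
        obtain ⟨ε, hε, rfl⟩ := (hcrit Q hQ).mp hs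
        have hlift : ∀ i, ∃ u : ℤˣ, ((u : ℤ) : ℝ) = ε i := fun i => by
          rcases hε i with h | h
          · exact ⟨1, by simp [h]⟩
          · exact ⟨-1, by simp [h]⟩
        choose s hs' using hlift
        exact ⟨s, by simp only [f, hs']⟩
      · rintro ⟨s, rfl⟩
        have hsign : ∀ i, ((s i : ℤ) : ℝ) = 1 ∨ ((s i : ℤ) : ℝ) = -1 := fun i => by
          rcases Int.units_eq_one_or (s i) with h | h <;> simp [h]
        have horth : f s * (f s)ᵀ = 1 := by
          have hd : diagonal (fun i => ((s i : ℤ) : ℝ)) * diagonal (fun i => ((s i : ℤ) : ℝ))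
              = 1 := by
            rw [diagonal_mul_diagonal, ← diagonal_one]
            congr 1
            funext i
            exact mul_self_eq_one_iff.mpr (hsign i)
          simp only [f, transpose_mul, transpose_transpose, diagonal_transpose]
          calc U * diagonal (fun i => ((s i : ℤ) : ℝ)) * Vᵀ *
                (V * (diagonal (fun i => ((s i : ℤ) : ℝ)) * Uᵀ))
              = U * (diagonal (fun i => ((s i : ℤ) : ℝ)) * (Vᵀ * V) *
                  diagonal (fun i => ((s i : ℤ) : ℝ))) * Uᵀ := by
                simp only [Matrix.mul_assoc]
            _ = 1 := by rw [hV', Matrix.mul_one, hd, Matrix.mul_one, hU]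
        exact ⟨horth, (hcrit _ horth).mpr ⟨_, hsign, rfl⟩⟩
    rw [hset, ← Nat.card_coe_set_eq, Nat.card_range_of_injective hf, Nat.card_eq_fintype_card,
      Fintype.card_fun, Fintype.card_units_int, Fintype.card_fin]
end

section
/- (Coordinate-free SVD, existence) Let V and U be finite-dimensional real inner product spaces and F : V → U a linear map with adjoint Fᵗ : U → V (characterized by ⟨F v, u⟩ = ⟨v, Fᵗ u⟩ for all v, u). Then there exist an integer k ≥ 0, real numbers σ₁ > σ₂ > … > σ_k > 0, and linear maps F_i : V → U for i = 1,…,k such that: F = σ₁F₁ + … + σ_kF_k; F_i F_jᵗ = 0 and F_iᵗ F_j = 0 whenever i ≠ j; and for each i, F_i restricted to the image of F_iᵗ is an isometry onto the image of F_i with inverse F_iᵗ (i.e. F_iᵗ F_i v = v and ‖F_i v‖ = ‖v‖ for all v in the image of F_iᵗ). -/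
open Module.End in
/-- The singular part of `F` at `s`: for `s > 0`, the partial isometry that agrees with `s⁻¹ • F`
on the `s ^ 2`-eigenspace of `Fᵗ F` and vanishes on its orthogonal complement. -/
noncomputable def LinearMap.singularPart {V U : Type*}
    [NormedAddCommGroup V] [InnerProductSpace ℝ V] [FiniteDimensional ℝ V]
    [NormedAddCommGroup U] [InnerProductSpace ℝ U] [FiniteDimensional ℝ U]
    (F : V →ₗ[ℝ] U) (s : ℝ) : V →ₗ[ℝ] U :=
  s⁻¹ • F ∘ₗ (eigenspace (F.adjoint ∘ₗ F) (s ^ 2)).starProjection.toLinearMap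

namespace LinearMap

open Module.End

variable {V U : Type*}
  [NormedAddCommGroup V] [InnerProductSpace ℝ V] [FiniteDimensional ℝ V]
  [NormedAddCommGroup U] [InnerProductSpace ℝ U] [FiniteDimensional ℝ U]
  (F : V →ₗ[ℝ] U)

theorem adjoint_starProjection (K : Submodule ℝ V) :
    adjoint K.starProjection.toLinearMap = K.starProjection.toLinearMap := by
  symm
  rw [eq_adjoint_iff]
  intro x y
  exact K.inner_starProjection_left_eq_right x y

theorem isOrtho_eigenspace_adjoint_comp_self {μ ν : ℝ} (h : μ ≠ ν) :
    eigenspace (F.adjoint ∘ₗ F) μ ⟂ eigenspace (F.adjoint ∘ₗ F) ν :=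
  F.isSymmetric_adjoint_comp_self.orthogonalFamily_eigenspaces.isOrtho h

theorem starProjection_eigenspace_apply_of_ne {μ ν : ℝ} (h : μ ≠ ν) {v : V}
    (hv : v ∈ eigenspace (F.adjoint ∘ₗ F) ν) :
    (eigenspace (F.adjoint ∘ₗ F) μ).starProjection v = 0 := by
  rw [Submodule.starProjection_apply_eq_zero_iff]
  exact (F.isOrtho_eigenspace_adjoint_comp_self h).symm hv

theorem adjoint_singularPart_apply (s : ℝ) (u : U) :
    adjoint (F.singularPart s) u =
      s⁻¹ • (eigenspace (F.adjoint ∘ₗ F) (s ^ 2)).starProjection (F.adjoint u) := by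
  simp [singularPart, adjoint_comp, adjoint_starProjection]

theorem singularPart_apply_of_mem {s : ℝ} {v : V}
    (hv : v ∈ eigenspace (F.adjoint ∘ₗ F) (s ^ 2)) : F.singularPart s v = s⁻¹ • F v := by
  simp [singularPart, Submodule.starProjection_eq_self_iff.mpr hv]

theorem singularPart_apply_of_ne {s μ : ℝ} (h : s ^ 2 ≠ μ) {v : V}
    (hv : v ∈ eigenspace (F.adjoint ∘ₗ F) μ) : F.singularPart s v = 0 := by
  simp [singularPart, F.starProjection_eigenspace_apply_of_ne h hv]

theorem adjoint_singularPart_mem (s : ℝ) (u : U) :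
    adjoint (F.singularPart s) u ∈ eigenspace (F.adjoint ∘ₗ F) (s ^ 2) := by
  rw [adjoint_singularPart_apply]
  exact Submodule.smul_mem _ _ (Submodule.starProjection_apply_mem _ _)

theorem singularPart_comp_adjoint {s t : ℝ} (h : s ^ 2 ≠ t ^ 2) :
    F.singularPart s ∘ₗ adjoint (F.singularPart t) = 0 := by
  ext u
  exact F.singularPart_apply_of_ne h (F.adjoint_singularPart_mem t u)

theorem adjoint_singularPart_comp {s t : ℝ} (h : s ^ 2 ≠ t ^ 2) :
    adjoint (F.singularPart s) ∘ₗ F.singularPart t = 0 := by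
  ext v
  set w := (eigenspace (F.adjoint ∘ₗ F) (t ^ 2)).starProjection v
  have hmem : w ∈ eigenspace (F.adjoint ∘ₗ F) (t ^ 2) := Submodule.starProjection_apply_mem _ _
  have hT : F.adjoint (F w) = t ^ 2 • w := mem_eigenspace_iff.mp hmem
  have ht : F.singularPart t v = t⁻¹ • F w := rfl
  rw [comp_apply, adjoint_singularPart_apply, ht]
  simp [hT, F.starProjection_eigenspace_apply_of_ne h hmem]

theorem adjoint_singularPart_singularPart {s : ℝ} (hs : s ≠ 0) {v : V}
    (hv : v ∈ eigenspace (F.adjoint ∘ₗ F) (s ^ 2)) :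
    adjoint (F.singularPart s) (F.singularPart s v) = v := by
  have hT : F.adjoint (F v) = s ^ 2 • v := mem_eigenspace_iff.mp hv
  rw [F.singularPart_apply_of_mem hv, adjoint_singularPart_apply, map_smul, hT, map_smul, map_smul,
    Submodule.starProjection_eq_self_iff.mpr hv, smul_smul, smul_smul]
  have : s⁻¹ * (s⁻¹ * s ^ 2) = 1 := by field_simp
  rw [← mul_assoc] at this
  rw [this, one_smul]

theorem norm_apply_sq_of_mem_eigenspace {μ : ℝ} {v : V}
    (hv : v ∈ eigenspace (F.adjoint ∘ₗ F) μ) : ‖F v‖ ^ 2 = μ * ‖v‖ ^ 2 := by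
  have hT : F.adjoint (F v) = μ • v := mem_eigenspace_iff.mp hv
  rw [← real_inner_self_eq_norm_sq, ← adjoint_inner_left, hT, real_inner_smul_left,
    real_inner_self_eq_norm_sq]

theorem norm_singularPart_apply {s : ℝ} (hs : s ≠ 0) {v : V}
    (hv : v ∈ eigenspace (F.adjoint ∘ₗ F) (s ^ 2)) : ‖F.singularPart s v‖ = ‖v‖ := by
  rw [← sq_eq_sq₀ (norm_nonneg _) (norm_nonneg _), ← real_inner_self_eq_norm_sq,
    ← adjoint_inner_left, F.adjoint_singularPart_singularPart hs hv, real_inner_self_eq_norm_sq]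

/-- `F` is the sum of its singular parts over any finite set of positive reals that contains all
the positive singular values. -/
theorem eq_sum_smul_singularPart {S : Finset ℝ} (hpos : ∀ s ∈ S, 0 < s)
    (hS : ∀ μ, 0 < μ → HasEigenvalue (F.adjoint ∘ₗ F) μ → √μ ∈ S) :
    F = ∑ s ∈ S, s • F.singularPart s := by
  have htop : ⨆ μ, eigenspace (F.adjoint ∘ₗ F) μ = ⊤ := by
    rw [← Submodule.orthogonal_eq_bot_iff]
    exact F.isSymmetric_adjoint_comp_self.orthogonalComplement_iSup_eigenspaces_eq_bot
  suffices h : ⨆ μ, eigenspace (F.adjoint ∘ₗ F) μ ≤ eqLocus F (∑ s ∈ S, s • F.singularPart s) by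
    ext v
    exact h (htop ▸ Submodule.mem_top : v ∈ _)
  refine iSup_le fun μ v hv => ?_
  rw [mem_eqLocus, sum_apply]
  have hnorm := F.norm_apply_sq_of_mem_eigenspace hv
  by_cases hF : F v = 0
  · rw [hF]
    refine (Finset.sum_eq_zero fun s _ => ?_).symm
    by_cases h : s ^ 2 = μ
    · subst h
      simp [F.singularPart_apply_of_mem hv, hF]
    · simp [F.singularPart_apply_of_ne h hv]
  have hμ : 0 < μ :=
    pos_of_mul_pos_left (hnorm ▸ pow_pos (norm_pos_iff.mpr hF) 2) (sq_nonneg _)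
  have hv0 : v ≠ 0 := fun h => hF (by rw [h, map_zero])
  have hmem : √μ ∈ S := hS μ hμ (hasEigenvalue_of_hasEigenvector ⟨hv, hv0⟩)
  rw [Finset.sum_eq_single_of_mem _ hmem]
  · rw [smul_apply, F.singularPart_apply_of_mem (by rwa [Real.sq_sqrt hμ.le]),
      smul_inv_smul₀ (Real.sqrt_pos.mpr hμ).ne']
  · intro s hs hne
    have h : s ^ 2 ≠ μ := by
      rintro rfl
      exact hne (Real.sqrt_sq (hpos s hs).le).symm
    rw [smul_apply, F.singularPart_apply_of_ne h hv, smul_zero]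

end LinearMap

/-- Coordinate-free SVD, existence: every linear map `F` between finite-dimensional
real inner product spaces decomposes as `F = Σ σᵢ Fᵢ` with `σ₁ > … > σ_k > 0`,
`Fᵢ Fⱼᵗ = 0` and `Fᵢᵗ Fⱼ = 0` for `i ≠ j`, and each `Fᵢ` restricted to the image of
`Fᵢᵗ` an isometry onto the image of `Fᵢ` with inverse `Fᵢᵗ`. -/
theorem coordinate_free_svd_exists
    {V U : Type*} [NormedAddCommGroup V] [InnerProductSpace ℝ V] [FiniteDimensional ℝ V]
    [NormedAddCommGroup U] [InnerProductSpace ℝ U] [FiniteDimensional ℝ U]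
    (F : V →ₗ[ℝ] U) :
    ∃ (k : ℕ) (σ : Fin k → ℝ) (G : Fin k → (V →ₗ[ℝ] U)),
      (∀ i, 0 < σ i) ∧ StrictAnti σ ∧
      F = ∑ i, σ i • G i ∧
      (∀ i j, i ≠ j →
        G i ∘ₗ LinearMap.adjoint (G j) = 0 ∧ LinearMap.adjoint (G i) ∘ₗ G j = 0) ∧
      (∀ i, ∀ v ∈ LinearMap.range (LinearMap.adjoint (G i)),
        LinearMap.adjoint (G i) (G i v) = v ∧ ‖G i v‖ = ‖v‖) := by
  set T := F.adjoint ∘ₗ F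
  have hfin : {μ | 0 < μ ∧ Module.End.HasEigenvalue T μ}.Finite :=
    (Module.End.finite_hasEigenvalue T).subset fun _ h => h.2
  set S : Finset ℝ := hfin.toFinset.image Real.sqrt
  have hpos : ∀ s ∈ S, 0 < s := by
    intro s hs
    obtain ⟨μ, hμ, rfl⟩ := Finset.mem_image.mp hs
    exact Real.sqrt_pos.mpr (hfin.mem_toFinset.mp hμ).1
  have hS : ∀ μ, 0 < μ → Module.End.HasEigenvalue T μ → √μ ∈ S := fun μ h0 h =>
    Finset.mem_image_of_mem _ (hfin.mem_toFinset.mpr ⟨h0, h⟩)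
  let e : Fin S.card ≃ S := Fin.revPerm.trans (S.orderIsoOfFin rfl).toEquiv
  have he : ∀ i, 0 < (e i : ℝ) := fun i => hpos _ (e i).2
  have hanti : StrictAnti fun i => (e i : ℝ) := fun i j hij =>
    (S.orderIsoOfFin rfl).strictMono (Fin.rev_lt_rev.mpr hij)
  refine ⟨S.card, fun i => e i, fun i => F.singularPart (e i), he, hanti, ?_, ?_, ?_⟩
  · rw [e.sum_comp fun s : S => (s : ℝ) • F.singularPart s,
      Finset.sum_coe_sort S fun s => s • F.singularPart s]
    exact F.eq_sum_smul_singularPart hpos hS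
  · intro i j hij
    have h : (e i : ℝ) ^ 2 ≠ (e j : ℝ) ^ 2 := fun h =>
      hij (hanti.injective ((sq_eq_sq₀ (he i).le (he j).le).mp h))
    exact ⟨F.singularPart_comp_adjoint h, F.adjoint_singularPart_comp h⟩
  · rintro i _ ⟨u, rfl⟩
    have hu := F.adjoint_singularPart_mem (e i) u
    exact ⟨F.adjoint_singularPart_singularPart (he i).ne' hu,
      F.norm_singularPart_apply (he i).ne' hu⟩
end

section
/- (Lim's variational principle) Let A be a real tensor of order d, i.e. a function A : ∏_{i=1}^d {0,…,n_i} → ℝ, with the Frobenius inner product ⟨A,B⟩ = Σ_j A(j)B(j). Let x_i ∈ ℝ^{n_i+1} be unit vectors for i = 1,…,d and λ ∈ ℝ, and let T = λ·(x_1⊗…⊗x_d) be the corresponding rank-one tensor, T(j₁,…,j_d) = λ·∏_i x_i(j_i). Then T is a critical point of the distance function from A to the variety of rank ≤ 1 tensors — i.e. ⟨A − T, x_1⊗…⊗x_{i-1}⊗u⊗x_{i+1}⊗…⊗x_d⟩ = 0 for every index i and every u ∈ ℝ^{n_i+1} — if and only if for every i the contraction of A against the remaining factors equals λ x_i, i.e.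 Σ_{j_1,…,ĵ_i,…,j_d} A(j_1,…,j_{i-1},q,j_{i+1},…,j_d) ∏_{k≠i} x_k(j_k) = λ x_i(q) for all q. Such a d-tuple (x_1,…,x_d) is called a singular vector d-tuple with singular value λ. -/
open Finset

/-- Multilinearity of the tensor inner product: two rank-one tensors with the same unit factors
outside the mode `i` have as inner product that of their factors in the mode `i`. -/
theorem sum_prod_mul_mul_prod_erase {ι : Type*} [Fintype ι] [DecidableEq ι] {κ : ι → Type*}
    [∀ i, Fintype (κ i)] {R : Type*} [CommSemiring R] (x : ∀ i, κ i → R)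
    (hx : ∀ i, ∑ q, x i q ^ 2 = 1) (i : ι) (u : κ i → R) :
    ∑ j : (∀ k, κ k), (∏ k, x k (j k)) * (u (j i) * ∏ k ∈ univ.erase i, x k (j k)) =
      ∑ q, x i q * u q := by
  have hprod (j : ∀ k, κ k) : (∏ k, x k (j k)) * (u (j i) * ∏ k ∈ univ.erase i, x k (j k)) =
      ∏ k, x k (j k) * Function.update x i u k (j k) := by
    rw [prod_mul_distrib, ← mul_prod_erase univ (fun k => Function.update x i u k (j k))
      (mem_univ i), Function.update_self]
    congr 2
    refine prod_congr rfl fun k hk => ?_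
    rw [Function.update_of_ne (ne_of_mem_erase hk)]
  simp_rw [hprod]
  rw [← Fintype.prod_sum fun k q => x k q * Function.update x i u k q,
    ← mul_prod_erase univ _ (mem_univ i), Function.update_self, prod_eq_one, mul_one]
  intro k hk
  simp_rw [Function.update_of_ne (ne_of_mem_erase hk), ← sq, hx]

/-- Pairing a function with a product of `u (j i)` groups the summands by the value of `j i`. -/
theorem sum_mul_apply_eq_sum_mul_sum_ite {ι κ R : Type*} [Fintype ι] [Fintype κ] [DecidableEq κ]
    [CommSemiring R] (f : ι → R) (g : ι → κ) (u : κ → R) :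
    ∑ j, f j * u (g j) = ∑ q, u q * ∑ j, if g j = q then f j else 0 := by
  simp_rw [mul_sum]
  rw [sum_comm]
  simp [mul_comm]

/-- Lim's variational principle: for unit vectors `x i` and `λ ∈ ℝ`, the rank-one
tensor `T = λ · x₁⊗…⊗x_d` is a critical point of the distance from the tensor `A`
to the rank ≤ 1 tensors (i.e. `A - T` is orthogonal to all tensors obtained from
`x₁⊗…⊗x_d` by replacing one factor with an arbitrary vector) iff for every mode `i`
the contraction of `A` against the other factors equals `λ • x i`, i.e. `(x₁,…,x_d)`
is a singular vector `d`-tuple with singular value `λ`. -/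
theorem lim_variational_principle {d : ℕ} (n : Fin d → ℕ)
    (A : (∀ i : Fin d, Fin (n i + 1)) → ℝ)
    (x : ∀ i : Fin d, Fin (n i + 1) → ℝ)
    (hx : ∀ i, ∑ q, (x i q) ^ 2 = 1)
    (lam : ℝ) :
    (∀ (i : Fin d) (u : Fin (n i + 1) → ℝ),
      ∑ j : (∀ k : Fin d, Fin (n k + 1)),
        (A j - lam * ∏ k, x k (j k)) * (u (j i) * ∏ k ∈ univ.erase i, x k (j k)) = 0) ↔
    (∀ (i : Fin d) (q : Fin (n i + 1)),
      (∑ j : (∀ k : Fin d, Fin (n k + 1)),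
        if j i = q then A j * ∏ k ∈ univ.erase i, x k (j k) else 0) = lam * x i q) := by
  have key (i : Fin d) (u : Fin (n i + 1) → ℝ) :
      ∑ j : (∀ k : Fin d, Fin (n k + 1)),
        (A j - lam * ∏ k, x k (j k)) * (u (j i) * ∏ k ∈ univ.erase i, x k (j k)) =
      ∑ q, u q * ((∑ j : (∀ k : Fin d, Fin (n k + 1)),
        if j i = q then A j * ∏ k ∈ univ.erase i, x k (j k) else 0) - lam * x i q) := by
    simp_rw [mul_sub]
    rw [sum_sub_distrib, ← sum_mul_apply_eq_sum_mul_sum_ite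
      (fun j => A j * ∏ k ∈ univ.erase i, x k (j k)) (fun j => j i) u]
    have h : ∑ q, u q * (lam * x i q) = lam * ∑ q, x i q * u q := by
      rw [mul_sum]
      exact sum_congr rfl fun q _ => by ring
    rw [h, ← sum_prod_mul_mul_prod_erase x hx i u, mul_sum, ← sum_sub_distrib]
    exact sum_congr rfl fun j _ => by ring
  simp_rw [key]
  refine forall_congr' fun i => ⟨fun h q => ?_, fun h u => ?_⟩
  · simpa [Pi.single_apply, sub_eq_zero] using h (Pi.single q 1)
  · simp [h]
end

section
/- (Lim's variational principle, symmetric case) Let A be a symmetric real tensor of order d on ℝ^{n+1}, i.e. a function A : {0,…,n}^d → ℝ invariant under every permutation of its d indices, with the Frobenius inner product ⟨A,B⟩ = Σ_j A(j)B(j). Let x ∈ ℝ^{n+1} be a unit vector and λ ∈ ℝ, and let T = λ·x^{⊗d}, i.e. T(j₁,…,j_d) = λ·∏_i x(j_i). Then T is a critical point of the distance function from A to the variety of rank ≤ 1 tensors — i.e. ⟨A − T, x^{⊗(i-1)}⊗u⊗x^{⊗(d-i)}⟩ = 0 for every position i and every u ∈ ℝ^{n+1} — if and only if A·x^{⊗(d-1)}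 = λ x, i.e. Σ_{j_2,…,j_d} A(q,j_2,…,j_d) ∏_{k=2}^d x(j_k) = λ x(q) for all q. Such an x is called an eigenvector of A with eigenvalue λ, and x^{⊗d} an eigentensor. -/
open Finset

/-- The contraction of a tensor `A` with the vector `x` in every position except `i`. -/
def contractExcept {ι κ : Type*} [Fintype ι] [DecidableEq ι] [Fintype κ] [DecidableEq κ]
    (A : (ι → κ) → ℝ) (x : κ → ℝ) (i : ι) (q : κ) : ℝ :=
  ∑ j : ι → κ, if j i = q then A j * ∏ k ∈ univ.erase i, x (j k) else 0

section contraction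

variable {ι κ : Type*} [Fintype ι] [DecidableEq ι] [Fintype κ]

lemma sum_prod_mul_eq_of_sum_sq_eq_one {x : κ → ℝ} (hx : ∑ q, (x q) ^ 2 = 1)
    (u : κ → ℝ) (i : ι) :
    ∑ j : ι → κ, (∏ k, x (j k)) * (u (j i) * ∏ k ∈ univ.erase i, x (j k)) =
      ∑ q, u q * x q := by
  have key : ∀ j : ι → κ,
      (∏ k, x (j k)) * (u (j i) * ∏ k ∈ univ.erase i, x (j k)) =
        ∏ k, (if k = i then u (j k) else x (j k)) * x (j k) := by
    intro j
    rw [prod_mul_distrib, mul_comm,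
      ← mul_prod_erase univ (fun k => if k = i then u (j k) else x (j k)) (mem_univ i), if_pos rfl]
    congr 2
    exact prod_congr rfl fun k hk => (if_neg (ne_of_mem_erase hk)).symm
  have hprod := prod_univ_sum (fun _ : ι => (univ : Finset κ))
    (fun k q => (if k = i then u q else x q) * x q)
  rw [Fintype.piFinset_univ] at hprod
  rw [sum_congr rfl fun j _ => key j, ← hprod, ← mul_prod_erase univ _ (mem_univ i),
    prod_eq_one, mul_one]
  · simp
  · intro k hk
    simpa [ne_of_mem_erase hk, ← pow_two] using hx

variable [DecidableEq κ]

lemma sum_mul_eq_sum_mul_contractExcept (A : (ι → κ) → ℝ) (x u : κ → ℝ) (i : ι) :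
    ∑ j : ι → κ, A j * (u (j i) * ∏ k ∈ univ.erase i, x (j k)) =
      ∑ q, u q * contractExcept A x i q := by
  simp only [contractExcept, mul_sum]
  rw [sum_comm]
  refine sum_congr rfl fun j _ => ?_
  simp only [mul_ite, mul_zero, sum_ite_eq, mem_univ, if_true]
  ring

lemma contractExcept_eq_of_symmetric {A : (ι → κ) → ℝ}
    (hA : ∀ (π : Equiv.Perm ι) (j : ι → κ), A (j ∘ π) = A j) (x : κ → ℝ) (i i' : ι) :
    contractExcept A x i = contractExcept A x i' := by
  funext q
  refine Fintype.sum_equiv (Equiv.arrowCongr (Equiv.swap i i') (Equiv.refl κ)) _ _ fun j => ?_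
  have hj : Equiv.arrowCongr (Equiv.swap i i') (Equiv.refl κ) j = j ∘ Equiv.swap i i' := by
    ext k
    simp
  have hp : ∏ k ∈ univ.erase i, x (j k) =
      ∏ k ∈ univ.erase i', x (j (Equiv.swap i i' k)) :=
    prod_equiv (Equiv.swap i i')
      (fun k => by simp [← Equiv.eq_symm_apply]) (fun k _ => by simp)
  rw [hj, hA, hp]
  simp

lemma sum_sub_rankOne_mul_eq {x : κ → ℝ} (hx : ∑ q, (x q) ^ 2 = 1) (A : (ι → κ) → ℝ)
    (c : ℝ) (u : κ → ℝ) (i : ι) :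
    ∑ j : ι → κ, (A j - c * ∏ k, x (j k)) * (u (j i) * ∏ k ∈ univ.erase i, x (j k)) =
      ∑ q, u q * (contractExcept A x i q - c * x q) := by
  simp only [sub_mul, mul_sub, sum_sub_distrib, mul_assoc]
  rw [sum_mul_eq_sum_mul_contractExcept, ← mul_sum, sum_prod_mul_eq_of_sum_sq_eq_one hx, mul_sum]
  simp only [mul_left_comm]

end contraction

/-- Lim's variational principle, symmetric case: for a symmetric tensor `A` of order
`d` on `ℝ^{n+1}`, a unit vector `x` and `λ ∈ ℝ`, the tensor `T = λ · x^{⊗d}` is a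
critical point of the distance from `A` to the rank ≤ 1 tensors iff
`A · x^{⊗(d-1)} = λ x`, i.e. `x` is an eigenvector of `A` with eigenvalue `λ`. -/
theorem lim_variational_principle_symmetric {d n : ℕ} (hd : 0 < d)
    (A : (Fin d → Fin (n + 1)) → ℝ)
    (hA : ∀ (π : Equiv.Perm (Fin d)) (j : Fin d → Fin (n + 1)), A (j ∘ π) = A j)
    (x : Fin (n + 1) → ℝ) (hx : ∑ q, (x q) ^ 2 = 1)
    (lam : ℝ) :
    (∀ (i : Fin d) (u : Fin (n + 1) → ℝ),
      ∑ j : Fin d → Fin (n + 1),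
        (A j - lam * ∏ k, x (j k)) * (u (j i) * ∏ k ∈ univ.erase i, x (j k)) = 0) ↔
    (∀ q : Fin (n + 1),
      (∑ j : Fin d → Fin (n + 1),
        if j ⟨0, hd⟩ = q then A j * ∏ k ∈ univ.erase ⟨0, hd⟩, x (j k) else 0) =
      lam * x q) := by
  simp only [sum_sub_rankOne_mul_eq hx]
  change _ ↔ ∀ q, contractExcept A x ⟨0, hd⟩ q = lam * x q
  constructor
  · intro h q
    have hq := h ⟨0, hd⟩ (Pi.single q 1)
    simp only [Pi.single_apply, ite_mul, one_mul, zero_mul, sum_ite_eq', mem_univ,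
      if_true] at hq
    exact sub_eq_zero.mp hq
  · intro h i u
    rw [contractExcept_eq_of_symmetric hA x i ⟨0, hd⟩]
    simp [h]
end

section
/- (Higher Order SVD, De Lathauwer–De Moor–Vandewalle) Let A be a complex tensor of format (n₁+1)×…×(n_d+1), i.e. a function A : ∏_{i=1}^d {0,…,n_i} → ℂ. Then there exist unitary matrices U_i of size (n_i+1)×(n_i+1) for i = 1,…,d and a tensor S of the same format with A(i₁,…,i_d) = Σ_{j₁,…,j_d} S(j₁,…,j_d) ∏_{k=1}^d (U_k)_{i_k j_k}, such that: (i) (all-orthogonality) for every mode k and all 0 ≤ α < β ≤ n_k, the slices S^k_α and S^k_β obtained from S by fixing the k-th index to α and β respectively are orthogonal for the Hermitian inner product, i.e. Σ_j conj(S^k_α(j)) · S^k_β(j) = 0; (ii) (ordering) for every mode k, the Hermitian norms of the slices satisfy ‖S^k_0‖ ≥ ‖S^k_1‖ ≥ … ≥ ‖S^k_{n_k}‖. -/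
open Finset Matrix

section MultilinearAction

variable {ι : Type*} [Fintype ι] {κ : ι → Type*}

/-- The Kronecker product of a finite family of square matrices. -/
def kron (W : ∀ i, Matrix (κ i) (κ i) ℂ) : Matrix (∀ i, κ i) (∀ i, κ i) ℂ :=
  fun j a => ∏ i, W i (j i) (a i)

lemma kron_conjTranspose (W : ∀ i, Matrix (κ i) (κ i) ℂ) :
    (kron W)ᴴ = kron fun i => (W i)ᴴ := by
  ext j a
  simp [kron, Matrix.conjTranspose_apply]

lemma kron_one [∀ i, DecidableEq (κ i)] :
    kron (fun i => (1 : Matrix (κ i) (κ i) ℂ)) = 1 := by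
  ext j a
  by_cases h : j = a
  · subst h; simp [kron]
  · obtain ⟨i, hi⟩ := Function.ne_iff.mp h
    rw [Matrix.one_apply_ne h]
    exact Finset.prod_eq_zero (Finset.mem_univ i) (Matrix.one_apply_ne hi)

variable [DecidableEq ι]

lemma kron_mul [∀ i, Fintype (κ i)] (V W : ∀ i, Matrix (κ i) (κ i) ℂ) :
    kron V * kron W = kron fun i => V i * W i := by
  ext j a
  simp only [kron, Matrix.mul_apply, Fintype.prod_sum, Finset.prod_mul_distrib]

lemma kron_update (W : ∀ i, Matrix (κ i) (κ i) ℂ) (k : ι) (M : Matrix (κ k) (κ k) ℂ)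
    (j a : ∀ i, κ i) :
    kron (Function.update W k M) j a =
      M (j k) (a k) * ∏ i ∈ univ.erase k, W i (j i) (a i) := by
  rw [kron, ← Finset.mul_prod_erase _ _ (Finset.mem_univ k), Function.update_self]
  congr 1
  refine Finset.prod_congr rfl fun i hi => ?_
  rw [Function.update_of_ne (Finset.ne_of_mem_erase hi)]

variable [∀ i, DecidableEq (κ i)]

lemma kron_update_one_single (k : ι) (α β : κ k) (j a : ∀ i, κ i) :
    kron (Function.update (fun _ => 1) k (Matrix.single α β 1)) j a =
      if j k = α ∧ a = Function.update j k β then 1 else 0 := by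
  rw [kron_update]
  split_ifs with h
  · obtain ⟨rfl, rfl⟩ := h
    rw [Finset.prod_eq_one]
    · simp
    · intro i hi
      rw [Function.update_of_ne (Finset.ne_of_mem_erase hi)]
      exact Matrix.one_apply_eq _
  · by_cases hj : j k = α ∧ a k = β
    · obtain ⟨i, hi⟩ := Function.ne_iff.mp fun ha => h ⟨hj.1, ha⟩
      have hik : i ≠ k := by
        rintro rfl
        simp [hj.2] at hi
      rw [Function.update_of_ne hik] at hi
      exact mul_eq_zero_of_right _ <|
        Finset.prod_eq_zero (Finset.mem_erase.mpr ⟨hik, Finset.mem_univ i⟩)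
          (Matrix.one_apply_ne hi.symm)
    · rw [Matrix.single_apply_of_ne _ _ _ _ _ fun h' => hj ⟨h'.1.symm, h'.2.symm⟩, zero_mul]

variable [∀ i, Fintype (κ i)]

/-- The Gram matrix of the slices of the tensor `T` in mode `k`. -/
def modeGram (T : (∀ i, κ i) → ℂ) (k : ι) : Matrix (κ k) (κ k) ℂ := fun α β =>
  star T ⬝ᵥ (kron (Function.update (fun _ => 1) k (Matrix.single α β 1)) *ᵥ T)

lemma modeGram_apply (T : (∀ i, κ i) → ℂ) (k : ι) (α β : κ k) :
    modeGram T k α β = ∑ j : ∀ i, κ i,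
      if j k = α then (starRingEnd ℂ) (T j) * T (Function.update j k β) else 0 := by
  simp only [modeGram, dotProduct, Matrix.mulVec, kron_update_one_single]
  refine Finset.sum_congr rfl fun j _ => ?_
  by_cases h : j k = α <;> simp [h]

lemma modeGram_apply_self (T : (∀ i, κ i) → ℂ) (k : ι) (α : κ k) :
    modeGram T k α α =
      ((∑ j : ∀ i, κ i, if j k = α then Complex.normSq (T j) else 0 : ℝ) : ℂ) := by
  rw [modeGram_apply, Complex.ofReal_sum]
  refine Finset.sum_congr rfl fun j _ => ?_
  split_ifs with h
  · subst h
    rw [Function.update_eq_self, Complex.normSq_eq_conj_mul_self]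
  · simp

lemma modeGram_isHermitian (T : (∀ i, κ i) → ℂ) (k : ι) : (modeGram T k).IsHermitian := by
  ext α β
  rw [Matrix.conjTranspose_apply, modeGram, modeGram, Matrix.star_dotProduct, star_star,
    Matrix.star_mulVec, ← Matrix.dotProduct_mulVec, kron_conjTranspose]
  congr 3
  funext i
  rcases eq_or_ne i k with rfl | hi
  · simp
  · simp [hi]

lemma dotProduct_kron_update_one (T : (∀ i, κ i) → ℂ) (k : ι) (M : Matrix (κ k) (κ k) ℂ) :
    star T ⬝ᵥ (kron (Function.update (fun _ => 1) k M) *ᵥ T) =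
      ∑ α, ∑ β, M α β * modeGram T k α β := by
  have h : kron (Function.update (fun _ => 1) k M) =
      ∑ α, ∑ β, M α β • kron (Function.update (fun _ => 1) k (Matrix.single α β 1)) := by
    ext j a
    simp only [Matrix.sum_apply, Matrix.smul_apply, kron_update, smul_eq_mul, ← mul_assoc,
      ← Finset.sum_mul]
    congr 1
    simp [Matrix.single_apply, ite_and]
  simp only [h, Matrix.sum_mulVec, Matrix.smul_mulVec, dotProduct_sum, dotProduct_smul,
    smul_eq_mul, modeGram]

/-- Unitary changes of basis in the other modes do not affect the Gram matrix of mode `k`. -/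
lemma modeGram_kron_mulVec (W : ∀ i, Matrix (κ i) (κ i) ℂ) (hW : ∀ i, (W i)ᴴ * W i = 1)
    (T : (∀ i, κ i) → ℂ) (k : ι) :
    modeGram (kron W *ᵥ T) k = (W k)ᴴᵀ * modeGram T k * (W k)ᵀ := by
  ext α β
  have h : (fun i => (W i)ᴴ * (Function.update (fun _ => 1) k (Matrix.single α β 1) :
      ∀ i, Matrix (κ i) (κ i) ℂ) i * W i) =
      Function.update (fun _ => 1) k ((W k)ᴴ * Matrix.single α β 1 * W k) := by
    funext i
    rcases eq_or_ne i k with rfl | hi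
    · simp
    · simp [hi, hW]
  rw [modeGram, Matrix.star_mulVec, ← Matrix.dotProduct_mulVec, Matrix.mulVec_mulVec,
    Matrix.mulVec_mulVec, kron_conjTranspose, kron_mul, kron_mul, h, dotProduct_kron_update_one]
  simp only [Matrix.mul_apply, Matrix.single_apply, Matrix.transpose_apply, Finset.sum_mul]
  rw [Finset.sum_comm]
  refine Finset.sum_congr rfl fun b _ => Finset.sum_congr rfl fun a _ => ?_
  simp [ite_and]
  ring

end MultilinearAction

/-- A Hermitian matrix has a unitary diagonalization with weakly decreasing eigenvalues. -/
lemma Matrix.IsHermitian.exists_antitone_diagonalization {m : ℕ}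
    {G : Matrix (Fin m) (Fin m) ℂ} (hG : G.IsHermitian) :
    ∃ (V : Matrix (Fin m) (Fin m) ℂ) (e : Fin m → ℝ), Vᴴ * V = 1 ∧ Antitone e ∧
      Vᴴ * G * V = Matrix.diagonal fun i => (e i : ℂ) := by
  set σ := Tuple.sort fun i => -hG.eigenvalues i
  set V : Matrix (Fin m) (Fin m) ℂ := hG.eigenvectorUnitary.1
  have hV : Vᴴ * V = 1 := Matrix.mem_unitaryGroup_iff'.mp hG.eigenvectorUnitary.2
  have hD : Vᴴ * G * V = Matrix.diagonal fun i => (hG.eigenvalues i : ℂ) := by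
    have h : G = V * (Matrix.diagonal fun i => (hG.eigenvalues i : ℂ)) * Vᴴ :=
      hG.spectral_theorem
    calc Vᴴ * G * V = (Vᴴ * V) * (Matrix.diagonal fun i => (hG.eigenvalues i : ℂ)) * (Vᴴ * V) := by
          conv_lhs => rw [h]
          simp only [mul_assoc]
      _ = _ := by rw [hV, one_mul, mul_one]
  refine ⟨V.submatrix id σ, hG.eigenvalues ∘ σ, ?_, ?_, ?_⟩
  · rw [Matrix.conjTranspose_submatrix, ← Matrix.submatrix_mul _ _ _ _ _ Function.bijective_id, hV,
      Matrix.submatrix_one_equiv]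
  · intro i j hij
    exact neg_le_neg_iff.mp (Tuple.monotone_sort (fun i => -hG.eigenvalues i) hij)
  · have hGσ : G.submatrix id id = G := Matrix.submatrix_id_id G
    rw [Matrix.conjTranspose_submatrix]
    conv_lhs => rw [← hGσ]
    rw [← Matrix.submatrix_mul _ _ _ _ _ Function.bijective_id,
      ← Matrix.submatrix_mul _ _ _ _ _ Function.bijective_id, hD, Matrix.submatrix_diagonal_equiv]
    rfl

/-- Higher Order SVD (De Lathauwer–De Moor–Vandewalle): any complex tensor `A` can be
written as the multilinear multiplication of a core tensor `S` by unitary matrices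
`U_k` in each mode, where the core `S` has pairwise Hermitian-orthogonal parallel
slices in every mode, with slice norms weakly decreasing in every mode. -/
theorem hosvd {d : ℕ} (n : Fin d → ℕ)
    (A : (∀ i : Fin d, Fin (n i + 1)) → ℂ) :
    ∃ (U : ∀ i : Fin d, Matrix (Fin (n i + 1)) (Fin (n i + 1)) ℂ)
      (S : (∀ i : Fin d, Fin (n i + 1)) → ℂ),
      (∀ i, U i * (U i)ᴴ = 1) ∧
      (∀ j : (∀ i : Fin d, Fin (n i + 1)),
        A j = ∑ j' : (∀ i : Fin d, Fin (n i + 1)), S j' * ∏ k, U k (j k) (j' k)) ∧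
      (∀ (k : Fin d) (α β : Fin (n k + 1)), α < β →
        (∑ j : (∀ i : Fin d, Fin (n i + 1)),
          if j k = α then (starRingEnd ℂ) (S j) * S (Function.update j k β) else 0) = 0) ∧
      (∀ (k : Fin d) (α β : Fin (n k + 1)), α ≤ β →
        Real.sqrt (∑ j : (∀ i : Fin d, Fin (n i + 1)),
            if j k = β then Complex.normSq (S j) else 0) ≤
          Real.sqrt (∑ j : (∀ i : Fin d, Fin (n i + 1)),
            if j k = α then Complex.normSq (S j) else 0)) := by
  choose V e hV he hD using fun k => (modeGram_isHermitian A k).exists_antitone_diagonalization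
  have hV' (k) : V k * (V k)ᴴ = 1 := mul_eq_one_comm.mp (hV k)
  have hW (k) : ((V k)ᵀ)ᴴ * (V k)ᵀ = 1 := by
    rw [Matrix.conjTranspose_transpose_eq_transpose_conjTranspose, ← Matrix.transpose_mul,
      hV', Matrix.transpose_one]
  have hG (k) : modeGram (kron (fun i => (V i)ᵀ) *ᵥ A) k =
      Matrix.diagonal fun i => (e k i : ℂ) := by
    rw [modeGram_kron_mulVec _ hW, ← hD]
    rfl
  have hnorm (k) (α : Fin (n k + 1)) : ∑ j : (∀ i : Fin d, Fin (n i + 1)),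
      (if j k = α then Complex.normSq ((kron (fun i => (V i)ᵀ) *ᵥ A) j) else 0) = e k α := by
    apply Complex.ofReal_injective
    rw [← modeGram_apply_self, hG, Matrix.diagonal_apply_eq]
  refine ⟨fun k => ((V k)ᵀ)ᴴ, kron (fun i => (V i)ᵀ) *ᵥ A, fun k => ?_, fun j => ?_,
    fun k α β h => ?_, fun k α β h => ?_⟩
  · rw [Matrix.conjTranspose_conjTranspose, hW]
  · have h : kron (fun k => ((V k)ᵀ)ᴴ) *ᵥ (kron (fun i => (V i)ᵀ) *ᵥ A) = A := by
      simp only [Matrix.mulVec_mulVec, kron_mul, hW, kron_one, Matrix.one_mulVec]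
    conv_lhs => rw [← h]
    exact Finset.sum_congr rfl fun _ _ => mul_comm _ _
  · rw [← modeGram_apply, hG, Matrix.diagonal_apply_ne _ h.ne]
  · rw [hnorm, hnorm]
    exact Real.sqrt_le_sqrt (he k h)
end

section
/- Let d ≥ 3 and n ≥ 0, and let A = x₀^d + x₁^d + … + x_n^d be the Fermat polynomial of degree d in the n+1 variables x₀,…,x_n over ℝ. Then the binomial(n+1,2) polynomials x_i·(∂A/∂x_j) − x_j·(∂A/∂x_i), for 0 ≤ i < j ≤ n, are linearly independent in the space of homogeneous polynomials of degree d. -/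
open MvPolynomial

theorem Finsupp.single_one_add_single_inj {σ : Type*} {e : ℕ} (he : 2 ≤ e) {i j k l : σ}
    (hij : i ≠ j) (hkl : k ≠ l) :
    (single i 1 + single j e : σ →₀ ℕ) = single k 1 + single l e ↔ i = k ∧ j = l := by
  classical
  refine ⟨fun h => ?_, by rintro ⟨rfl, rfl⟩; rfl⟩
  have hi := DFunLike.congr_fun h i
  have hj := DFunLike.congr_fun h j
  simp only [Finsupp.add_apply, Finsupp.single_apply] at hi hj
  grind

theorem MvPolynomial.pderiv_sum_X_pow {σ R : Type*} [Fintype σ] [CommSemiring R] (d : ℕ) (j : σ) :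
    pderiv j (∑ i, X i ^ d : MvPolynomial σ R) = C (d : R) * X j ^ (d - 1) := by
  classical
  simp [pderiv_X, Pi.single_apply]

theorem MvPolynomial.X_mul_pderiv_sum_X_pow {σ R : Type*} [Fintype σ] [CommSemiring R]
    (d : ℕ) (i j : σ) :
    X i * pderiv j (∑ k, X k ^ d : MvPolynomial σ R) =
      monomial (Finsupp.single i 1 + Finsupp.single j (d - 1)) (d : R) := by
  rw [pderiv_sum_X_pow, mul_left_comm, X_pow_eq_monomial, X, monomial_mul, C_mul_monomial]
  simp

/-- For the Fermat polynomial `A = Σ xᵢ^d` with `d ≥ 3`, the `(n+1 choose 2)`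
polynomials `xᵢ ∂A/∂xⱼ − xⱼ ∂A/∂xᵢ` for `i < j` are linearly independent. -/
theorem fermat_singular_space_equations_independent (d n : ℕ) (hd : 3 ≤ d) :
    LinearIndependent ℝ
      (fun p : {p : Fin (n + 1) × Fin (n + 1) // p.1 < p.2} =>
        (X p.1.1 : MvPolynomial (Fin (n + 1)) ℝ) * pderiv p.1.2 (∑ i, X i ^ d) -
          X p.1.2 * pderiv p.1.1 (∑ i, X i ^ d)) := by
  have he : 2 ≤ d - 1 := by omega
  rw [Fintype.linearIndependent_iff]
  intro g hg q
  have hcoeff := congrArg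
    (coeff (Finsupp.single q.1.1 1 + Finsupp.single q.1.2 (d - 1))) hg
  simp only [X_mul_pderiv_sum_X_pow, coeff_sum, coeff_smul, coeff_sub, coeff_monomial,
    coeff_zero, smul_eq_mul] at hcoeff
  rw [Finset.sum_eq_single q] at hcoeff
  · rw [if_pos rfl, if_neg, sub_zero] at hcoeff
    · exact (mul_eq_zero.mp hcoeff).resolve_right (by norm_cast; omega)
    · rw [Finsupp.single_one_add_single_inj he q.2.ne' q.2.ne]
      exact fun h => q.2.ne h.2
  · intro p _ hpq
    rw [if_neg, if_neg, sub_zero, mul_zero]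
    · rw [Finsupp.single_one_add_single_inj he p.2.ne' q.2.ne]
      rintro ⟨h₁, h₂⟩
      exact lt_asymm p.2 (h₁ ▸ h₂ ▸ q.2)
    · rw [Finsupp.single_one_add_single_inj he p.2.ne q.2.ne]
      exact fun h => hpq (Subtype.ext (Prod.ext h.1 h.2))
  · simp
end
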